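/- Let K be a field, F ∈ K[X] a polynomial, and ρ ∈ K. In the field K((X)) of formal Laurent series, for every integer n ≥ 0, the coefficient of Xⁿ in F(X⁻¹)·(1−ρX)⁻² equals (n+1)·ρⁿ·F(ρ) + ρ^{n+1}·F′(ρ), where F′ is the formal derivative of F. Equivalently, the nonnegative-degree part of F(1/x)/(1−ρx)² equals F(ρ)/(1−ρx)² + ρ·F′(ρ)/(1−ρx) (the double-pole case of the paper's 'nonnegative part at a pole' lemma, with the derivative as given by its proof). -/

import Mathlib

open Polynomial

theorem aux_ps {K : Type*} [Field K] (ρ : K) :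
    (PowerSeries.mk fun m : ℕ => ((m : K) + 1) * ρ ^ m) *
      (1 - PowerSeries.X * PowerSeries.C ρ) = PowerSeries.mk fun m : ℕ => ρ ^ m := by
  ext m
  rw [mul_sub, mul_one, ← mul_assoc, map_sub, PowerSeries.coeff_mul_C]
  cases m with
  | zero => simp
  | succ m =>
    rw [PowerSeries.coeff_succ_mul_X]
    simp only [PowerSeries.coeff_mk]
    push_cast
    ring

theorem aux_ps' {K : Type*} [Field K] (ρ : K) :
    (PowerSeries.mk fun m : ℕ => ρ ^ m) *
      (1 - PowerSeries.X * PowerSeries.C ρ) = 1 := by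
  ext m
  rw [mul_sub, mul_one, ← mul_assoc, map_sub, PowerSeries.coeff_mul_C]
  cases m with
  | zero => simp
  | succ m =>
    rw [PowerSeries.coeff_succ_mul_X]
    simp only [PowerSeries.coeff_mk, PowerSeries.coeff_one]
    simp [pow_succ]

theorem aux_inv {K : Type*} [Field K] (ρ : K) :
    ((1 - HahnSeries.single (1 : ℤ) ρ : LaurentSeries K)⁻¹) ^ 2 =
      HahnSeries.ofPowerSeries ℤ K (PowerSeries.mk fun m : ℕ => ((m : K) + 1) * ρ ^ m) := by
  have h1 : (1 - HahnSeries.single (1 : ℤ) ρ : LaurentSeries K) =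
      HahnSeries.ofPowerSeries ℤ K (1 - PowerSeries.X * PowerSeries.C ρ) := by
    rw [map_sub, map_one, map_mul, HahnSeries.ofPowerSeries_X, HahnSeries.ofPowerSeries_C,
      HahnSeries.C_apply, HahnSeries.single_mul_single]
    simp
  rw [h1, inv_pow]
  apply inv_eq_of_mul_eq_one_right
  rw [← map_pow, ← map_mul, mul_comm, pow_two, ← mul_assoc, aux_ps, aux_ps', map_one]

/-- The paper's 'nonnegative part at a pole' lemma (double pole): in the field of
formal Laurent series `K((X))`, for a polynomial `F ∈ K[X]` and `ρ ∈ K`, the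
coefficient of `Xⁿ` (for `n ≥ 0`) in `F(X⁻¹)·(1 − ρX)⁻²` equals
`(n+1)·ρⁿ·F(ρ) + ρ^{n+1}·F′(ρ)`, where `F′` is the formal derivative of `F`. -/
theorem stmt_14 {K : Type*} [Field K] (F : Polynomial K) (ρ : K) (n : ℕ) :
    ((F.eval₂ (HahnSeries.C : K →+* LaurentSeries K) (HahnSeries.single (-1 : ℤ) 1)) *
        ((1 - HahnSeries.single (1 : ℤ) ρ)⁻¹) ^ 2).coeff (n : ℤ) =
      (n + 1 : K) * ρ ^ n * F.eval ρ + ρ ^ (n + 1) * (derivative F).eval ρ := by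
  rw [aux_inv]
  induction F using Polynomial.induction_on' with
  | add p q hp hq =>
    rw [eval₂_add, add_mul, HahnSeries.coeff_add, hp, hq, derivative_add, eval_add, eval_add]
    ring
  | monomial k a =>
    rw [eval₂_monomial, HahnSeries.single_pow, one_pow, HahnSeries.C_apply,
      HahnSeries.single_mul_single, HahnSeries.coeff_single_mul]
    have : (n : ℤ) - (0 + k • (-1 : ℤ)) = ((n + k : ℕ) : ℤ) := by simp
    rw [this, HahnSeries.ofPowerSeries_apply_coeff, PowerSeries.coeff_mk, derivative_monomial,
      eval_monomial, eval_monomial]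
    cases k with
    | zero => simp; ring
    | succ k => simp; ring
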